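/- Fixed-visit-number generating function (Eq. (3.14), K = 0 case): for every real λ with 0 < λ < 1, every integer Z ≥ 1 and every integer X, ∑_{N=0}^∞ λ^N P_N(X, 0 | Z) = ((1+α²)/(1−α²)) (α^{|X|} − α^{Z + |X−Z|}), where α = (1 − √(1−λ²))/λ. -/

import Mathlib

open Finset Filter Real

noncomputable section

/-- A walk path of length `N` is `ε : Fin N → Bool`; `true` means a `+1` step,
`false` a `-1` step. `S ε n` is the partial sum `S_n` of the first `n` steps. -/
def S {N : ℕ} (ε : Fin N → Bool) (n : ℕ) : ℤ :=
  ∑ i ∈ Finset.univ.filter (fun i : Fin N => (i : ℕ) < n), (if ε i then (1 : ℤ) else -1)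

/-- `p N X`: probability the simple symmetric random walk is at `X` after `N` steps. -/
def p (N : ℕ) (X : ℤ) : ℝ :=
  ((Finset.univ.filter (fun ε : Fin N → Bool => S ε N = X)).card : ℝ) / 2 ^ N

/-- Number of visits of the path `ε` to site `Z` at times `n ∈ {1, …, N}`. -/
def visits (N : ℕ) (Z : ℤ) (ε : Fin N → Bool) : ℕ :=
  ((Finset.Icc 1 N).filter (fun n => S ε n = Z)).card

/-- `P N X K Z`: joint probability that after `N` steps the walk is at `X`
and has visited `Z` exactly `K` times. -/
def P (N : ℕ) (X : ℤ) (K : ℕ) (Z : ℤ) : ℝ :=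
  ((Finset.univ.filter
      (fun ε : Fin N → Bool => S ε N = X ∧ visits N Z ε = K)).card : ℝ) / 2 ^ N

/-- `Pmarg N K Z`: probability of exactly `K` visits to `Z` in the first `N` steps. -/
def Pmarg (N : ℕ) (K : ℕ) (Z : ℤ) : ℝ :=
  ((Finset.univ.filter (fun ε : Fin N → Bool => visits N Z ε = K)).card : ℝ) / 2 ^ N

theorem S_snoc_of_le {N : ℕ} (b : Bool) (ε : Fin N → Bool) {n : ℕ} (hn : n ≤ N) :
    S (Fin.snoc ε b : Fin (N + 1) → Bool) n = S ε n := by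
  simp [S, Finset.sum_filter, Fin.sum_univ_castSucc, hn]

theorem S_snoc_succ {N : ℕ} (b : Bool) (ε : Fin N → Bool) :
    S (Fin.snoc ε b : Fin (N + 1) → Bool) (N + 1) = S ε N + if b then 1 else -1 := by
  simp [S, Finset.sum_filter, Fin.sum_univ_castSucc]

theorem visits_eq_zero_iff {N : ℕ} {Z : ℤ} {ε : Fin N → Bool} :
    visits N Z ε = 0 ↔ ∀ n, 1 ≤ n → n ≤ N → S ε n ≠ Z := by
  simp [visits, Finset.filter_eq_empty_iff]

theorem visits_snoc_eq_zero_iff {N : ℕ} {Z : ℤ} (b : Bool) (ε : Fin N → Bool) :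
    visits (N + 1) Z (Fin.snoc ε b : Fin (N + 1) → Bool) = 0 ↔
      visits N Z ε = 0 ∧ S (Fin.snoc ε b : Fin (N + 1) → Bool) (N + 1) ≠ Z := by
  simp only [visits_eq_zero_iff]
  constructor
  · refine fun h => ⟨fun n h1 hn => ?_, h _ (by omega) le_rfl⟩
    rw [← S_snoc_of_le b ε hn]
    exact h n h1 (by omega)
  · rintro ⟨h, h'⟩ n h1 hn
    obtain rfl | hn := Nat.eq_or_lt_of_le hn
    · exact h'
    · rw [S_snoc_of_le b ε (by omega)]
      exact h n h1 (by omega)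

theorem P_zero_zero (X Z : ℤ) : P 0 X 0 Z = if X = 0 then 1 else 0 := by
  by_cases h : X = 0
  · simp [P, S, visits, h]
  · simp [P, S, visits, h, Ne.symm h]

/-- Decomposition of the no-visit probability according to the last step. -/
theorem P_succ_zero (N : ℕ) (X Z : ℤ) :
    P (N + 1) X 0 Z = if X = Z then 0 else (P N (X - 1) 0 Z + P N (X + 1) 0 Z) / 2 := by
  have key : (Finset.univ.filter
      (fun ε : Fin (N + 1) → Bool => S ε (N + 1) = X ∧ visits (N + 1) Z ε = 0)).card =
      if X = Z then 0 else
        (Finset.univ.filter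
          (fun ε : Fin N → Bool => S ε N = X - 1 ∧ visits N Z ε = 0)).card +
        (Finset.univ.filter
          (fun ε : Fin N → Bool => S ε N = X + 1 ∧ visits N Z ε = 0)).card := by
    simp only [Finset.card_filter]
    rw [← (Fin.snocEquiv (fun _ : Fin (N + 1) => Bool)).sum_comp, Fintype.sum_prod_type,
      Fintype.sum_bool]
    simp only [Fin.snocEquiv, Equiv.coe_fn_mk, visits_snoc_eq_zero_iff, S_snoc_succ,
      Bool.false_eq_true, if_true, if_false]
    split_ifs with h
    · subst h
      simp only [Nat.add_eq_zero_iff, Finset.sum_eq_zero_iff]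
      constructor <;> intro ε _ <;> exact if_neg (by tauto)
    · congr 1 <;> refine Finset.sum_congr rfl fun ε _ => if_congr ?_ rfl rfl <;>
        grind
  unfold P
  rw [key]
  split_ifs
  · simp
  · push_cast
    rw [pow_succ]
    ring

theorem P_nonneg (N : ℕ) (X : ℤ) (K : ℕ) (Z : ℤ) : 0 ≤ P N X K Z := by
  unfold P
  positivity

/-- A bounded solution of the first-step equation for the walk killed at `Z` is the
no-visit generating function. -/
theorem hasSum_of_recurrence {l : ℝ} (hl0 : 0 < l) (hl1 : l < 1) {Z : ℤ} {F : ℤ → ℝ} {M : ℝ}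
    (hM : ∀ X, |F X| ≤ M)
    (hF : ∀ X, F X = (if X = 0 then 1 else 0) +
      if X = Z then 0 else l / 2 * (F (X - 1) + F (X + 1))) (X : ℤ) :
    HasSum (fun N : ℕ => l ^ N * P N X 0 Z) (F X) := by
  have bound (n : ℕ) : ∀ X, |(∑ N ∈ Finset.range n, l ^ N * P N X 0 Z) - F X| ≤ l ^ n * M := by
    induction n with
    | zero => simpa using hM
    | succ n ih =>
      intro X
      have hM0 : 0 ≤ M := (abs_nonneg _).trans (hM 0)
      rw [Finset.sum_range_succ', hF X, P_zero_zero]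
      by_cases h : X = Z
      · simp only [P_succ_zero, h, if_true]
        simp only [mul_zero, Finset.sum_const_zero, pow_zero, one_mul, zero_add, add_zero,
          sub_self, abs_zero]
        positivity
      · have hs : ∑ N ∈ Finset.range n, l ^ (N + 1) * P (N + 1) X 0 Z =
            l / 2 * (∑ N ∈ Finset.range n, l ^ N * P N (X - 1) 0 Z +
              ∑ N ∈ Finset.range n, l ^ N * P N (X + 1) 0 Z) := by
          rw [← Finset.sum_add_distrib, Finset.mul_sum]
          refine Finset.sum_congr rfl fun N _ => ?_
          rw [P_succ_zero, if_neg h]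
          ring
        have h1 := abs_le.1 (ih (X - 1))
        have h2 := abs_le.1 (ih (X + 1))
        rw [hs, if_neg h, pow_succ, abs_le]
        constructor <;> nlinarith
  rw [hasSum_iff_tendsto_nat_of_nonneg
    (fun N => mul_nonneg (pow_nonneg hl0.le N) (P_nonneg N X 0 Z)), tendsto_iff_norm_sub_tendsto_zero]
  refine squeeze_zero (fun _ => norm_nonneg _) (fun n => bound n X) ?_
  simpa using (tendsto_pow_atTop_nhds_zero_of_lt_one hl0.le hl1).mul_const M

theorem pow_natAbs_eq_of_ne_zero {l α : ℝ} (h : l * (1 + α ^ 2) = 2 * α) {k : ℤ} (hk : k ≠ 0) :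
    α ^ k.natAbs = l / 2 * (α ^ (k - 1).natAbs + α ^ (k + 1).natAbs) := by
  obtain hk | hk := hk.lt_or_gt
  · obtain ⟨m, hm⟩ : ∃ m, (k + 1).natAbs = m := ⟨_, rfl⟩
    rw [show (k - 1).natAbs = m + 2 by omega, show k.natAbs = m + 1 by omega, hm]
    linear_combination -(α ^ m / 2) * h
  · obtain ⟨m, hm⟩ : ∃ m, (k - 1).natAbs = m := ⟨_, rfl⟩
    rw [show (k + 1).natAbs = m + 2 by omega, show k.natAbs = m + 1 by omega, hm]
    linear_combination -(α ^ m / 2) * h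

/-- Eq. (3.14), `K = 0` case: the no-visit generating function. -/
theorem no_visit_generating_function (l : ℝ) (hl0 : 0 < l) (hl1 : l < 1)
    (Z X : ℤ) (hZ : 1 ≤ Z)
    (α : ℝ) (hα : α = (1 - Real.sqrt (1 - l ^ 2)) / l) :
    HasSum (fun N : ℕ => l ^ N * P N X 0 Z)
      ((1 + α ^ 2) / (1 - α ^ 2)
        * (α ^ X.natAbs - α ^ (Z + |X - Z|).toNat)) := by
  have hs2 : Real.sqrt (1 - l ^ 2) ^ 2 = 1 - l ^ 2 := Real.sq_sqrt (by nlinarith)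
  have hs0 : 0 < Real.sqrt (1 - l ^ 2) := Real.sqrt_pos.2 (by nlinarith)
  have hlα : l * α = 1 - Real.sqrt (1 - l ^ 2) := by rw [hα]; field_simp
  have h : l * (1 + α ^ 2) = 2 * α := by
    refine mul_left_cancel₀ hl0.ne' ?_
    linear_combination (l * α - 1 - Real.sqrt (1 - l ^ 2)) * hlα + hs2
  have hα0 : 0 < α := by nlinarith [sq_nonneg α]
  have hα1 : α < 1 := by nlinarith [sq_nonneg (α - 1)]
  have hd : 0 < 1 - α ^ 2 := by nlinarith
  have hpow (n : ℕ) : 0 ≤ α ^ n ∧ α ^ n ≤ 1 := ⟨by positivity, pow_le_one₀ hα0.le hα1.le⟩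
  have hexp (X : ℤ) : α ^ (Z + |X - Z|).toNat = α ^ Z.natAbs * α ^ (X - Z).natAbs := by
    rw [← pow_add]
    congr 1
    have := Int.abs_eq_natAbs (X - Z)
    omega
  refine hasSum_of_recurrence
    (F := fun X => (1 + α ^ 2) / (1 - α ^ 2) * (α ^ X.natAbs - α ^ (Z + |X - Z|).toNat))
    (M := (1 + α ^ 2) / (1 - α ^ 2)) hl0 hl1 (fun X => ?_) (fun X => ?_) X
  · have hc : 0 ≤ (1 + α ^ 2) / (1 - α ^ 2) := by positivity
    rw [abs_mul, abs_of_nonneg hc]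
    refine mul_le_of_le_one_right hc (abs_le.2 ?_)
    constructor <;> linarith [hpow X.natAbs, hpow (Z + |X - Z|).toNat]
  · simp only [hexp]
    by_cases hXZ : X = Z
    · subst hXZ
      simp [show X ≠ 0 by omega]
    · have hv := pow_natAbs_eq_of_ne_zero h (sub_ne_zero.2 hXZ)
      rw [if_neg hXZ, hv, show X - 1 - Z = X - Z - 1 by ring, show X + 1 - Z = X - Z + 1 by ring]
      by_cases hX : X = 0
      · subst hX
        simp only [if_true, Int.natAbs_zero, pow_zero, zero_sub, zero_add, Int.natAbs_neg,
          Int.natAbs_one, pow_one]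
        field_simp
        linear_combination -2 * α * h
      · rw [if_neg hX, pow_natAbs_eq_of_ne_zero h hX]
        ring
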